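/- Let g be a finite-dimensional Lie algebra over a field of characteristic zero and let h be a Lie subalgebra of g whose radical r_h (viewed as a subspace of g) is contained in the center of g. Then for any Lie subalgebra k of g containing h, h is a subideal of k (there is a finite chain h = l₀ ⊴ l₁ ⊴ ⋯ ⊴ lₙ = k of subalgebras of k, each an ideal of the next) if and only if h is an ideal of k (⁅k, h⁆ ⊆ h). -/

import Mathlib

/-- `a` is an ideal of `b` (for Lie subalgebras `a ≤ b` of `g`). -/
def LieSubalgebra.IsIdealOf {K : Type*} [Field K] {g : Type*} [LieRing g] [LieAlgebra K g]
    (a b : LieSubalgebra K g) : Prop :=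
  a ≤ b ∧ ∀ x ∈ b, ∀ y ∈ a, ⁅x, y⁆ ∈ a

/-- `a` is a subideal of `b`: there is a finite chain of Lie subalgebras from `a` to `b`,
each an ideal of the next. -/
def LieSubalgebra.IsSubidealOf {K : Type*} [Field K] {g : Type*} [LieRing g] [LieAlgebra K g]
    (a b : LieSubalgebra K g) : Prop :=
  ∃ (n : ℕ) (l : Fin (n + 1) → LieSubalgebra K g), l 0 = a ∧ l (Fin.last n) = b ∧
    ∀ i : Fin n, (l i.castSucc).IsIdealOf (l i.succ)

namespace LieAlgebra

/-- The quotient of a Lie algebra by an ideal, as a morphism of Lie algebras. -/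
def quotientHom {R L : Type*} [CommRing R] [LieRing L] [LieAlgebra R L] (I : LieIdeal R L) :
    L →ₗ⁅R⁆ L ⧸ I :=
  { (LieSubmodule.Quotient.mk' I : L →ₗ[R] L ⧸ I) with
    map_lie' := fun {x y} ↦ LieSubmodule.Quotient.mk_bracket I x y }

theorem quotientHom_surjective {R L : Type*} [CommRing R] [LieRing L] [LieAlgebra R L]
    (I : LieIdeal R L) : Function.Surjective (quotientHom I) :=
  LieSubmodule.Quotient.surjective_mk' I

theorem quotientHom_eq_zero {R L : Type*} [CommRing R] [LieRing L] [LieAlgebra R L]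
    {I : LieIdeal R L} {x : L} : quotientHom I x = 0 ↔ x ∈ I :=
  LieSubmodule.Quotient.mk_eq_zero I

theorem isSolvable_of_lie_self_le {R L : Type*} [CommRing R] [LieRing L] [LieAlgebra R L]
    {I J : LieIdeal R L} [IsSolvable I] (hJ : ⁅J, J⁆ ≤ I) : IsSolvable J := by
  obtain ⟨k, hk⟩ := IsSolvable.solvable R I
  rw [LieIdeal.derivedSeries_eq_bot_iff] at hk
  refine IsSolvable.mk (R := R) (k := k + 1) ?_
  rw [LieIdeal.derivedSeries_eq_bot_iff, derivedSeriesOfIdeal_add, ← le_bot_iff, ← hk]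
  exact derivedSeriesOfIdeal_mono hJ k

theorem hasTrivialRadical_quotient_radical (R L : Type*) [CommRing R] [LieRing L]
    [LieAlgebra R L] [IsNoetherian R L] : HasTrivialRadical R (L ⧸ radical R L) := by
  rw [hasTrivialRadical_iff_no_abelian_ideals]
  intro I hI
  rw [LieSubmodule.lie_abelian_iff_lie_self_eq_bot] at hI
  have hsolv : IsSolvable (I.comap (quotientHom (radical R L))) := by
    refine isSolvable_of_lie_self_le (I := radical R L) ?_
    rw [LieSubmodule.lieIdeal_oper_eq_span, LieSubmodule.lieSpan_le]
    rintro _ ⟨x, y, rfl⟩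
    rw [SetLike.mem_coe, ← quotientHom_eq_zero, LieHom.map_lie, ← LieSubmodule.mem_bot (R := R)
      (L := L ⧸ radical R L), ← hI]
    exact LieSubmodule.lie_mem_lie (LieIdeal.mem_comap.mp x.2) (LieIdeal.mem_comap.mp y.2)
  rw [LieIdeal.solvable_iff_le_radical] at hsolv
  rw [LieSubmodule.eq_bot_iff]
  intro z hz
  obtain ⟨x, rfl⟩ := quotientHom_surjective _ z
  exact quotientHom_eq_zero.mpr (hsolv (LieIdeal.mem_comap.mpr hz))

theorem IsSemisimple.derivedSeries_one_eq_top (R L : Type*) [CommRing R] [LieRing L]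
    [LieAlgebra R L] [IsSemisimple R L] : derivedSeries R L 1 = ⊤ := by
  rw [← top_le_iff, ← IsSemisimple.sSup_atoms_eq_top (R := R) (L := L), sSup_le_iff]
  intro J hJ
  have hne : ⁅J, J⁆ ≠ ⊥ := fun h ↦ IsSemisimple.non_abelian_of_isAtom J hJ
    ((LieSubmodule.lie_abelian_iff_lie_self_eq_bot J).mpr h)
  have heq : ⁅J, J⁆ = J := (hJ.le_iff.mp (LieSubmodule.lie_le_left J J)).resolve_left hne
  rw [← heq]
  exact LieSubmodule.mono_lie le_top le_top

/-- In characteristic zero, a finite-dimensional Lie algebra is the sum of its derived ideal and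
its radical. -/
theorem derivedSeries_one_sup_radical (K L : Type*) [Field K] [CharZero K] [LieRing L]
    [LieAlgebra K L] [FiniteDimensional K L] : derivedSeries K L 1 ⊔ radical K L = ⊤ := by
  have := hasTrivialRadical_quotient_radical K L
  have hfin : FiniteDimensional K (L ⧸ radical K L) :=
    Module.Finite.of_surjective (quotientHom (radical K L) : L →ₗ[K] L ⧸ radical K L)
      (quotientHom_surjective _)
  have hmap := LieIdeal.derivedSeries_map_eq 1 (quotientHom_surjective (radical K L))
  rw [IsSemisimple.derivedSeries_one_eq_top K (L ⧸ radical K L)] at hmap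
  rw [← top_le_iff]
  intro x _
  have hx : quotientHom (radical K L) x ∈ (derivedSeries K L 1).map (quotientHom (radical K L)) :=
    hmap ▸ LieSubmodule.mem_top _
  obtain ⟨y, hy⟩ := LieIdeal.mem_map_of_surjective (quotientHom_surjective _) hx
  rw [LieSubmodule.mem_sup]
  refine ⟨y, y.2, x - y, quotientHom_eq_zero.mp ?_, add_sub_cancel _ _⟩
  rw [map_sub, hy, sub_self]

end LieAlgebra

namespace LieSubalgebra

variable {K : Type*} [Field K] {g : Type*} [LieRing g] [LieAlgebra K g]

theorem IsIdealOf.trans_of_radical_central [CharZero K] {a b c : LieSubalgebra K g}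
    [FiniteDimensional K a]
    (hrad : ∀ x : a, x ∈ LieAlgebra.radical K a → (x : g) ∈ LieAlgebra.center K g)
    (hab : a.IsIdealOf b) (hbc : b.IsIdealOf c) : a.IsIdealOf c := by
  refine ⟨hab.1.trans hbc.1, fun x hx y hy ↦ ?_⟩
  have hderiv : ∀ z ∈ LieAlgebra.derivedSeries K a 1, ⁅x, (z : g)⁆ ∈ a := by
    intro z hz
    replace hz : z ∈ Submodule.span K {⁅u, v⁆ | (u : a) (v : a)} :=
      LieAlgebra.coe_derivedSeries_one_eq K a ▸ hz
    induction hz using Submodule.span_induction with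
    | mem z hz =>
      obtain ⟨u, v, rfl⟩ := hz
      rw [coe_bracket, leibniz_lie]
      refine add_mem (hab.2 _ (hbc.2 x hx _ (hab.1 u.2)) _ v.2) ?_
      rw [← lie_skew]
      exact neg_mem (hab.2 _ (hbc.2 x hx _ (hab.1 v.2)) _ u.2)
    | zero => simp
    | add u v _ _ hu hv => simpa using add_mem hu hv
    | smul t u _ hu => simpa using a.smul_mem t hu
  have hmem : (⟨y, hy⟩ : a) ∈ LieAlgebra.derivedSeries K a 1 ⊔ LieAlgebra.radical K a := by
    rw [LieAlgebra.derivedSeries_one_sup_radical]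
    exact LieSubmodule.mem_top _
  rw [LieSubmodule.mem_sup] at hmem
  obtain ⟨u, hu, v, hv, huv⟩ := hmem
  have hy' : y = u + v := congrArg Subtype.val huv.symm
  have hv0 : ⁅x, (v : g)⁆ = 0 := (LieModule.mem_maxTrivSubmodule K g g (v : g)).mp (hrad v hv) x
  rw [hy', lie_add, hv0, add_zero]
  exact hderiv u hu

end LieSubalgebra

/-- If the radical of `h` (viewed in `g`) is contained in the center of `g`, then for any Lie
subalgebra `k` of `g` containing `h`, the algebra `h` is a subideal of `k` iff it is an ideal
of `k`. -/
theorem subideal_iff_ideal_of_radical_central {K : Type*} [Field K] [CharZero K] {g : Type*}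
    [LieRing g] [LieAlgebra K g] [FiniteDimensional K g] (h : LieSubalgebra K g)
    (hrad : ∀ x : h, x ∈ LieAlgebra.radical K h → (x : g) ∈ LieAlgebra.center K g) :
    ∀ k : LieSubalgebra K g, h ≤ k →
      (h.IsSubidealOf k ↔ ∀ x ∈ k, ∀ y ∈ h, ⁅x, y⁆ ∈ h) := by
  intro k hk
  constructor
  · rintro ⟨n, l, h0, hn, hl⟩
    have hind : ∀ i : Fin (n + 1), h.IsIdealOf (l i) := by
      intro i
      induction i using Fin.induction with
      | zero => exact h0 ▸ ⟨le_rfl, fun x hx y hy ↦ (l 0).lie_mem hx hy⟩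
      | succ i ih => exact ih.trans_of_radical_central hrad (hl i)
    exact hn ▸ (hind (Fin.last n)).2
  · intro hid
    refine ⟨1, ![h, k], rfl, rfl, fun i ↦ ?_⟩
    fin_cases i
    exact ⟨hk, hid⟩
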